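/- arXiv:2112.12664 — 3 statements merged into one kernel-verified Lean document; each statement's English description precedes it below -/
import Mathlib

section
/- Let n, T ∈ ℕ with T ≥ 1, ω ≥ 0, and let data points ẋʲ ∈ ℝⁿ and stacked regressors gʲ ∈ ℝᴺ (gʲ = (zʲ, vʲ)) for j = 0,…,T−1 be given. Define cⱼ := −ωI + ẋʲ(ẋʲ)ᵀ ∈ ℝⁿˣⁿ, bⱼ := −gʲ(ẋʲ)ᵀ ∈ ℝᴺˣⁿ, aⱼ := gʲ(gʲ)ᵀ ∈ ℝᴺˣᴺ, and let G := [g⁰ ⋯ g^{T−1}] ∈ ℝᴺˣᵀ and X₁ := [ẋ⁰ ⋯ ẋ^{T−1}] ∈ ℝⁿˣᵀ. Assume (i) G has full row rank (equivalently GGᵀ is positive definite), and (ii) there exists ζ⋆ ∈ ℝᴺˣⁿ such that (X₁ − ζ⋆ᵀG)(X₁ − ζ⋆ᵀG)ᵀ ⪯ TωI. Then there exist scalars τ₀,…,τ_{T−1} ≥ 0, a positive definite matrix A_i ∈ ℝᴺˣᴺ, and a matrix B_i ∈ ℝᴺˣⁿ such that the block matrix [[−I − Σⱼ τⱼcⱼ,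 B_iᵀ − Σⱼ τⱼbⱼᵀ, B_iᵀ], [B_i − Σⱼ τⱼbⱼ, A_i − Σⱼ τⱼaⱼ, 0], [B_i, 0, −A_i]] is negative semidefinite. -/
open Matrix

/-- The sum of the outer products `uⱼ vⱼᵀ` is the product of the matrices with columns `uⱼ`, `vⱼ`. -/
theorem sum_vecMulVec_eq_of_mul_transpose_of {ι m k R : Type*} [Fintype ι]
    [NonUnitalNonAssocSemiring R] (u : ι → m → R) (v : ι → k → R) :
    ∑ j, vecMulVec (u j) (v j) =
      (of fun i j => u j i : Matrix m ι R) * (of fun i j => v j i : Matrix k ι R)ᵀ := by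
  ext i l
  simp [Matrix.sum_apply, vecMulVec_apply, mul_apply]

/-- Feasibility of the over-approximation SDP: if the stacked regressor matrix `G` has full
row rank (`GGᵀ ≻ 0`) and some `ζ⋆` is consistent with the data under the energy bound
(`(X₁ − ζ⋆ᵀG)(X₁ − ζ⋆ᵀG)ᵀ ⪯ TωI`), then there exist multipliers `τⱼ ≥ 0`, `A_i ≻ 0`
and `B_i` making the LMI block matrix negative semidefinite. -/
theorem sdp_feasibility (n T : ℕ) (hT : 1 ≤ T) (N : ℕ) (ω : ℝ) (hω : 0 ≤ ω)
    (xdot : Fin T → Fin n → ℝ) (g : Fin T → Fin N → ℝ)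
    (c : Fin T → Matrix (Fin n) (Fin n) ℝ)
    (hc : ∀ j, c j = -(ω • (1 : Matrix (Fin n) (Fin n) ℝ)) + vecMulVec (xdot j) (xdot j))
    (b : Fin T → Matrix (Fin N) (Fin n) ℝ)
    (hb : ∀ j, b j = -vecMulVec (g j) (xdot j))
    (a : Fin T → Matrix (Fin N) (Fin N) ℝ)
    (ha : ∀ j, a j = vecMulVec (g j) (g j))
    (G : Matrix (Fin N) (Fin T) ℝ) (hG : G = Matrix.of fun i j => g j i)
    (X1 : Matrix (Fin n) (Fin T) ℝ) (hX1 : X1 = Matrix.of fun i j => xdot j i)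
    (hrank : (G * Gᵀ).PosDef)
    (hconsist : ∃ ζstar : Matrix (Fin N) (Fin n) ℝ,
      (((T : ℝ) * ω) • (1 : Matrix (Fin n) (Fin n) ℝ) -
        (X1 - ζstarᵀ * G) * (X1 - ζstarᵀ * G)ᵀ).PosSemidef) :
    ∃ (τ : Fin T → ℝ) (Ai : Matrix (Fin N) (Fin N) ℝ) (Bi : Matrix (Fin N) (Fin n) ℝ),
      (∀ j, 0 ≤ τ j) ∧ Ai.PosDef ∧
      (-(Matrix.fromBlocks
          (-(1 : Matrix (Fin n) (Fin n) ℝ) - ∑ j, τ j • c j)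
          (Matrix.fromCols (Biᵀ - ∑ j, τ j • (b j)ᵀ) Biᵀ)
          (Matrix.fromRows (Bi - ∑ j, τ j • b j) Bi)
          (Matrix.fromBlocks (Ai - ∑ j, τ j • a j) 0 0 (-Ai)))).PosSemidef := by
  have hXX : ∑ j, vecMulVec (xdot j) (xdot j) = X1 * X1ᵀ := by
    subst hX1; exact sum_vecMulVec_eq_of_mul_transpose_of xdot xdot
  have hGX : ∑ j, vecMulVec (g j) (xdot j) = G * X1ᵀ := by
    subst hX1 hG; exact sum_vecMulVec_eq_of_mul_transpose_of g xdot
  have hGG : ∑ j, vecMulVec (g j) (g j) = G * Gᵀ := by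
    subst hG; exact sum_vecMulVec_eq_of_mul_transpose_of g g
  have hTω : 0 ≤ (T : ℝ) * ω := by positivity
  obtain ⟨t, ht, hts⟩ : ∃ t : ℝ, 0 < t ∧ 0 ≤ 1 - t * (T * ω) := by
    refine ⟨((T : ℝ) * ω + 1)⁻¹, by positivity, ?_⟩
    rw [sub_nonneg, inv_mul_le_iff₀ (by positivity)]
    linarith
  have hsumc : ∑ j, t • c j = -((t * (T * ω)) • (1 : Matrix (Fin n) (Fin n) ℝ))
      + t • (X1 * X1ᵀ) := by
    simp only [hc, ← Finset.smul_sum, Finset.sum_add_distrib, hXX, Finset.sum_const,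
      Finset.card_univ, Fintype.card_fin]
    module
  have hsumb : ∑ j, t • b j = -(t • (G * X1ᵀ)) := by
    simp only [hb, ← Finset.smul_sum, Finset.sum_neg_distrib, hGX, smul_neg]
  have hsumbT : ∑ j, t • (b j)ᵀ = -(t • (X1 * Gᵀ)) := by
    have h := congrArg transpose hsumb
    simpa [transpose_sum] using h
  have hsuma : ∑ j, t • a j = t • (G * Gᵀ) := by
    simp only [ha, ← Finset.smul_sum, hGG]
  refine ⟨fun _ => t, t • (G * Gᵀ), -(t • (G * X1ᵀ)), fun _ => ht.le, hrank.smul ht, ?_⟩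
  -- The negated block matrix is `(1 - tTω) E + t W Wᵀ` with `W = [X₁; 0; G]`.
  have hdiag : (fromBlocks ((1 - t * (T * ω)) • (1 : Matrix (Fin n) (Fin n) ℝ)) 0 0
      (0 : Matrix (Fin N ⊕ Fin N) (Fin N ⊕ Fin N) ℝ)).PosSemidef := by
    rw [smul_one_eq_diagonal, ← diagonal_zero, fromBlocks_diagonal]
    refine PosSemidef.diagonal fun i => ?_
    rcases i with i | i <;> simp [hts]
  have hgram := (posSemidef_self_mul_conjTranspose
    (fromRows X1 (fromRows (0 : Matrix (Fin N) (Fin T) ℝ) G))).smul ht.le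
  convert hdiag.add hgram using 1
  rw [hsumc, hsumb, hsumbT, hsuma, conjTranspose_eq_transpose_of_trivial]
  ext (i | i | i) (j | j | j) <;>
    simp [transpose_fromRows]
  ring
end

section
/- Let n, m, N_A, N_B, T ∈ ℕ, N := N_A + N_B, ε > 0, ω ≥ 0. Let Z : ℝⁿ → ℝ^{N_A} and W : ℝⁿ → ℝ^{N_B×m} have polynomial entries, and let A★ ∈ ℝ^{n×N_A}, B★ ∈ ℝ^{n×N_B}. Suppose data points ẋʲ ∈ ℝⁿ, zʲ ∈ ℝ^{N_A}, vʲ ∈ ℝ^{N_B} (j = 0,…,T−1) satisfy ẋʲ = A★zʲ + B★vʲ + dʲ with ‖dʲ‖² ≤ ω for each j. With gʲ := (zʲ, vʲ) ∈ ℝᴺ, define cⱼ := −ωI + ẋʲ(ẋʲ)ᵀ, bⱼ := −gʲ(ẋʲ)ᵀ, aⱼ := gʲ(gʲ)ᵀ, and suppose there exist τⱼ ≥ 0, a positive definite A_i ∈ ℝᴺˣᴺ and B_i ∈ ℝᴺˣⁿ such that [[−I − Σⱼ τⱼcⱼ, B_iᵀ − Σⱼ τⱼbⱼᵀ, B_iᵀ],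 [B_i − Σⱼ τⱼbⱼ, A_i − Σⱼ τⱼaⱼ, 0], [B_i, 0, −A_i]] ⪯ 0. Set ζ̄ := −A_i⁻¹B_i, let P̄ be the positive definite square root of A_i⁻¹, and Q̄ := I. Suppose there exist polynomials ℓ, η, h in n variables and a vector K of m polynomials in n variables such that for all x ∈ ℝⁿ: η(x) > 0 and the symmetric matrix H(x) := [[ℓ(x)h(x) + ε + ∇h(x)·(ζ̄ᵀw(x)), η(x)(P̄w(x))ᵀ, ∇h(x)ᵀ], [η(x)P̄w(x), −2η(x)I, 0], [∇h(x), 0, −2η(x)I]] is negative semidefinite, where w(x) := (Z(x), W(x)K(x)) ∈ ℝᴺ and ∇h(x) is the gradient of h. Then the set I := {x ∈ ℝⁿ : h(x) ≤ 0} is invariant for the closed loop ẋ = A★Z(x) + B★W(x)K(x): every differentiable curve x : [0,T') → ℝⁿ with x'(t) = A★Z(x(t)) + B★W(x(t))K(x(t)) for all t and h(x(0)) ≤ 0 satisfies h(x(t)) ≤ 0 for all t ∈ [0,T'). -/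
open Matrix MvPolynomial
open scoped ENNReal

/-- The gradient of a multivariate polynomial, as a vector of evaluated partial derivatives. -/
noncomputable def gradPoly {n : ℕ} (h : MvPolynomial (Fin n) ℝ) (x : Fin n → ℝ) : Fin n → ℝ :=
  fun i => eval x (pderiv i h)

/-- Chain rule for a polynomial along a differentiable curve. -/
theorem hasDerivWithinAt_eval_comp {n : ℕ} (p : MvPolynomial (Fin n) ℝ) {y : ℝ → Fin n → ℝ}
    {y' : Fin n → ℝ} {s : Set ℝ} {t : ℝ} (hy : HasDerivWithinAt y y' s t) :
    HasDerivWithinAt (fun r => eval (y r) p) (gradPoly p (y t) ⬝ᵥ y') s t := by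
  induction p using MvPolynomial.induction_on with
  | C a => simpa [gradPoly, dotProduct] using hasDerivWithinAt_const t s a
  | add p q hp hq =>
    have hadd := hp.fun_add hq
    simp only [gradPoly, dotProduct] at hadd
    simpa only [gradPoly, dotProduct, map_add, add_mul, Finset.sum_add_distrib] using hadd
  | mul_X p i hp =>
    have hgrad : gradPoly (p * X i) (y t) ⬝ᵥ y' =
        gradPoly p (y t) ⬝ᵥ y' * y t i + eval (y t) p * y' i := by
      simp only [gradPoly, dotProduct, Derivation.leibniz, smul_eq_mul, map_add, map_mul, eval_X,
        pderiv_X, add_mul, Finset.sum_add_distrib, Finset.sum_mul]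
      rw [add_comm]
      congr 1
      · exact Finset.sum_congr rfl fun j _ => by ring
      · simp [Pi.single_apply, apply_ite (eval (y t))]
    rw [hgrad]
    simpa only [map_mul, eval_X] using hp.fun_mul (hasDerivWithinAt_pi.mp hy i)

/-- A vector with squared norm at most `ω` satisfies the matrix bound `d dᵀ ⪯ ω I`. -/
theorem dotProduct_sq_le_mul_of_sum_sq_le {ι : Type*} [Fintype ι] {ω : ℝ} {d : ι → ℝ}
    (hd : ∑ i, d i ^ 2 ≤ ω) (u : ι → ℝ) : (d ⬝ᵥ u) ^ 2 ≤ ω * (u ⬝ᵥ u) := by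
  calc (d ⬝ᵥ u) ^ 2 ≤ (∑ i, d i ^ 2) * ∑ i, u i ^ 2 := Finset.sum_mul_sq_le_sq_mul_sq _ _ _
    _ ≤ ω * ∑ i, u i ^ 2 := by gcongr
    _ = ω * (u ⬝ᵥ u) := by simp [dotProduct, sq]

/-- Every parameter matrix `ζ` consistent with the noisy data lies in the matrix ellipsoid
described by a feasible point `(A, B)` of the over-approximation LMI. -/
theorem ellipsoid_bound_of_lmi {ι κ J : Type*} [Fintype ι] [DecidableEq ι] [Fintype κ]
    [DecidableEq κ] [Fintype J] {ω : ℝ} (ζ : Matrix κ ι ℝ)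
    (xdot : J → ι → ℝ) (g : J → κ → ℝ)
    (hdata : ∀ j, ∑ i, (xdot j - ζᵀ *ᵥ g j) i ^ 2 ≤ ω)
    (τ : J → ℝ) (hτ : ∀ j, 0 ≤ τ j) {A : Matrix κ κ ℝ} (hA : A.PosDef) (B : Matrix κ ι ℝ)
    (hLMI : (-(Matrix.fromBlocks
        (-(1 : Matrix ι ι ℝ) -
          ∑ j, τ j • (-(ω • (1 : Matrix ι ι ℝ)) + vecMulVec (xdot j) (xdot j)))
        (Matrix.fromCols (Bᵀ - ∑ j, τ j • (-vecMulVec (g j) (xdot j))ᵀ) Bᵀ)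
        (Matrix.fromRows (B - ∑ j, τ j • (-vecMulVec (g j) (xdot j))) B)
        (Matrix.fromBlocks (A - ∑ j, τ j • vecMulVec (g j) (g j)) 0 0 (-A)))).PosSemidef)
    (u : ι → ℝ) :
    ((ζ + A⁻¹ * B) *ᵥ u) ⬝ᵥ (A *ᵥ ((ζ + A⁻¹ * B) *ᵥ u)) ≤ u ⬝ᵥ u := by
  set y := ζ *ᵥ u
  set s := (A⁻¹ * B) *ᵥ u with hs
  have hBu : B *ᵥ u = A *ᵥ s := by
    rw [hs, mulVec_mulVec, ← Matrix.mul_assoc, mul_nonsing_inv _ hA.det_pos.ne'.isUnit,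
      Matrix.one_mul]
  have hsymm : y ⬝ᵥ (A *ᵥ s) = s ⬝ᵥ (A *ᵥ y) := by
    have hAt : Aᵀ = A := by simpa using hA.isHermitian.eq
    rw [dotProduct_comm, ← hAt, mulVec_transpose, ← dotProduct_mulVec, hAt]
  have hform := hLMI.dotProduct_mulVec_nonneg (Sum.elim u (Sum.elim y s))
  have hnoise : ∀ j, τ j * ((xdot j ⬝ᵥ u - g j ⬝ᵥ y) ^ 2 - ω * (u ⬝ᵥ u)) ≤ 0 := fun j => by
    have hd := dotProduct_sq_le_mul_of_sum_sq_le (hdata j) u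
    rw [sub_dotProduct, mulVec_transpose, ← dotProduct_mulVec] at hd
    exact mul_nonpos_of_nonneg_of_nonpos (hτ j) (sub_nonpos.mpr hd)
  have hsum := Finset.sum_nonpos fun j (_ : j ∈ Finset.univ) => hnoise j
  have hBy : u ⬝ᵥ (Bᵀ *ᵥ y) = y ⬝ᵥ (A *ᵥ s) := by
    rw [mulVec_transpose, dotProduct_comm, ← dotProduct_mulVec, hBu]
  have hBs : u ⬝ᵥ (Bᵀ *ᵥ s) = s ⬝ᵥ (A *ᵥ s) := by
    rw [mulVec_transpose, dotProduct_comm, ← dotProduct_mulVec, hBu]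
  have hexp : ∑ j, τ j * ((xdot j ⬝ᵥ u - g j ⬝ᵥ y) ^ 2 - ω * (u ⬝ᵥ u)) =
      ∑ j, τ j * (-(ω * (u ⬝ᵥ u)) + (xdot j ⬝ᵥ u) * (xdot j ⬝ᵥ u)) -
        2 * ∑ j, τ j * ((xdot j ⬝ᵥ u) * (g j ⬝ᵥ y)) +
        ∑ j, τ j * ((g j ⬝ᵥ y) * (g j ⬝ᵥ y)) := by
    rw [Finset.mul_sum, ← Finset.sum_sub_distrib, ← Finset.sum_add_distrib]
    exact Finset.sum_congr rfl fun j _ => by ring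
  have hcomm : ∀ j, u ⬝ᵥ xdot j = xdot j ⬝ᵥ u := fun j => dotProduct_comm _ _
  have hcomm' : ∀ j, y ⬝ᵥ g j = g j ⬝ᵥ y := fun j => dotProduct_comm _ _
  simp only [star_trivial, neg_mulVec, dotProduct_neg, fromBlocks_mulVec, Sum.elim_comp_inl,
    Sum.elim_comp_inr, fromCols_mulVec_sumElim, fromRows_mulVec, ← Sum.elim_add_add,
    sumElim_dotProduct_sumElim, zero_mulVec, sub_mulVec, add_mulVec, sum_mulVec, smul_mulVec,
    one_mulVec, transpose_neg, transpose_vecMulVec, vecMulVec_mulVec, dotProduct_add,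
    dotProduct_sub, dotProduct_sum, dotProduct_smul, hBu, hBy, hBs, hcomm, hcomm',
    smul_eq_mul, MulOpposite.smul_eq_mul_unop, MulOpposite.unop_op, mul_neg,
    Finset.sum_neg_distrib, add_zero, zero_add] at hform
  simp only [mul_comm (g _ ⬝ᵥ y) (xdot _ ⬝ᵥ u)] at hform
  rw [add_mulVec, mulVec_add, add_dotProduct, dotProduct_add, dotProduct_add]
  linarith

/-- Schur-complement consequence of the barrier certificate, for an arbitrary vector `r` playing
the role of the parameter uncertainty applied to the gradient. -/
theorem add_dotProduct_nonpos_of_certificate {ι κ : Type*} [Fintype ι] [DecidableEq ι] [Fintype κ]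
    [DecidableEq κ] {A P : Matrix κ κ ℝ} (hA : A.PosDef) (hP : P.PosDef) (hPP : P * P = A⁻¹)
    {θ η : ℝ} (hη : 0 < η) (w r : κ → ℝ) (q : ι → ℝ) (hr : r ⬝ᵥ (A *ᵥ r) ≤ q ⬝ᵥ q)
    (hH : (-(Matrix.fromBlocks
      (Matrix.of fun (_ _ : Fin 1) => θ)
      (Matrix.fromCols (Matrix.of fun (_ : Fin 1) j => η * (P *ᵥ w) j)
        (Matrix.of fun (_ : Fin 1) j => q j))
      (Matrix.fromRows (Matrix.of fun i (_ : Fin 1) => η * (P *ᵥ w) i)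
        (Matrix.of fun i (_ : Fin 1) => q i))
      (Matrix.fromBlocks ((-(2 * η)) • (1 : Matrix κ κ ℝ)) 0
        0 ((-(2 * η)) • (1 : Matrix ι ι ℝ))))).PosSemidef) :
    θ + r ⬝ᵥ w ≤ 0 := by
  have hform := hH.dotProduct_mulVec_nonneg
    (Sum.elim (fun _ => 1) (Sum.elim ((1 / 2 : ℝ) • (P *ᵥ w)) ((1 / (2 * η)) • q)))
  have hschur : θ + η / 2 * ((P *ᵥ w) ⬝ᵥ (P *ᵥ w)) + 1 / (2 * η) * (q ⬝ᵥ q) ≤ 0 := by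
    have hdiag : (fun _ : Fin 1 => (1 : ℝ)) ⬝ᵥ (of fun (_ _ : Fin 1) => θ) *ᵥ (fun _ => 1) = θ := by
      simp [dotProduct, mulVec]
    have hrowP : (fun _ : Fin 1 => (1 : ℝ)) ⬝ᵥ (of fun (_ : Fin 1) j => η * (P *ᵥ w) j) *ᵥ
        ((1 / 2 : ℝ) • (P *ᵥ w)) = (η • (P *ᵥ w)) ⬝ᵥ ((1 / 2 : ℝ) • (P *ᵥ w)) := by
      rw [dotProduct, Fin.sum_univ_one, one_mul]
      rfl
    have hcolP : ((of fun i (_ : Fin 1) => η * (P *ᵥ w) i) *ᵥ fun _ => (1 : ℝ)) = η • (P *ᵥ w) := by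
      ext i; simp [dotProduct, mulVec]
    have hcolq : ((of fun i (_ : Fin 1) => q i) *ᵥ fun _ => (1 : ℝ)) = q := by
      ext i; simp [dotProduct, mulVec]
    have hrowq : (fun _ : Fin 1 => (1 : ℝ)) ⬝ᵥ (of fun (_ : Fin 1) j => q j) *ᵥ
        ((1 / (2 * η)) • q) = q ⬝ᵥ ((1 / (2 * η)) • q) := by
      simp [dotProduct, mulVec]
    simp only [star_trivial, neg_mulVec, dotProduct_neg, fromBlocks_mulVec, Sum.elim_comp_inl,
      Sum.elim_comp_inr, fromCols_mulVec_sumElim, fromRows_mulVec, sumElim_dotProduct_sumElim,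
      zero_mulVec, smul_mulVec, one_mulVec, dotProduct_add, hdiag, hrowP, hrowq, hcolP, hcolq,
      smul_dotProduct, dotProduct_smul, dotProduct_zero, smul_eq_mul] at hform
    refine (le_of_eq ?_).trans (neg_nonneg.mp hform)
    field_simp
    ring
  have hPw : (P *ᵥ w) ⬝ᵥ (P *ᵥ w) = w ⬝ᵥ (A⁻¹ *ᵥ w) := by
    have hPt : Pᵀ = P := by simpa using hP.isHermitian.eq
    rw [← hPP, ← mulVec_mulVec, dotProduct_mulVec w, ← mulVec_transpose, hPt]
  have hyoung := hA.posSemidef.dotProduct_mulVec_nonneg (r - η • (A⁻¹ *ᵥ w))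
  have hAt : Aᵀ = A := by simpa using hA.isHermitian.eq
  have hinv : A *ᵥ (A⁻¹ *ᵥ w) = w := by
    rw [mulVec_mulVec, mul_nonsing_inv _ hA.det_pos.ne'.isUnit, one_mulVec]
  have hcross : (A⁻¹ *ᵥ w) ⬝ᵥ (A *ᵥ r) = r ⬝ᵥ w := by
    rw [dotProduct_mulVec, ← mulVec_transpose, hAt, hinv, dotProduct_comm]
  simp only [star_trivial, mulVec_sub, mulVec_smul, hinv, sub_dotProduct, dotProduct_sub,
    smul_dotProduct, dotProduct_smul, hcross, smul_eq_mul] at hyoung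
  rw [dotProduct_comm (A⁻¹ *ᵥ w), ← hPw] at hyoung
  have hbound : r ⬝ᵥ w ≤ η / 2 * ((P *ᵥ w) ⬝ᵥ (P *ᵥ w)) + 1 / (2 * η) * (q ⬝ᵥ q) := by
    rw [← sub_nonneg]
    have : 0 ≤ 1 / (2 * η) * (η ^ 2 * ((P *ᵥ w) ⬝ᵥ (P *ᵥ w)) + q ⬝ᵥ q - 2 * η * (r ⬝ᵥ w)) := by
      apply mul_nonneg (by positivity)
      linarith
    convert this using 1
    field_simp
  linarith

/-- A function starting at a nonpositive value stays nonpositive on an interval `[0, T')` if its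
derivative is negative wherever it vanishes. -/
theorem nonpos_of_deriv_neg_of_eq_zero {f f' : ℝ → ℝ} {T' : ℝ≥0∞}
    (hf : ∀ t ∈ {s : ℝ | 0 ≤ s ∧ ENNReal.ofReal s < T'},
      HasDerivWithinAt f (f' t) {s : ℝ | 0 ≤ s ∧ ENNReal.ofReal s < T'} t)
    (hneg : ∀ t ∈ {s : ℝ | 0 ≤ s ∧ ENNReal.ofReal s < T'}, f t = 0 → f' t < 0)
    (h0 : f 0 ≤ 0) : ∀ t ∈ {s : ℝ | 0 ≤ s ∧ ENNReal.ofReal s < T'}, f t ≤ 0 := by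
  intro t ht
  have hsub : Set.Icc 0 t ⊆ {s : ℝ | 0 ≤ s ∧ ENNReal.ofReal s < T'} := fun s hs =>
    ⟨hs.1, (ENNReal.ofReal_le_ofReal hs.2).trans_lt ht.2⟩
  refine image_le_of_deriv_right_lt_deriv_boundary (f := f) (f' := f') (B := fun _ => 0)
    (B' := fun _ => 0) (a := 0) (b := t)
    (fun s hs => ((hf s (hsub hs)).continuousWithinAt).mono hsub) ?_ h0
    (fun s => hasDerivAt_const s 0)
    (fun s hs => hneg s (hsub ⟨hs.1, hs.2.le⟩)) ⟨ht.1, le_rfl⟩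
  intro s hs
  refine (hf s (hsub ⟨hs.1, hs.2.le⟩)).mono_of_mem_nhdsWithin ?_
  exact Filter.mem_of_superset (Icc_mem_nhdsGE hs.2)
    ((Set.Icc_subset_Icc_left hs.1).trans hsub)

/-- Data-driven invariance: if noisy data generated by `ẋ = A★Z(x) + B★W(x)u + d` with
`‖dʲ‖² ≤ ω` admit a feasible over-approximating ellipsoid `(A_i, B_i)` (via the LMI), and
polynomials `ℓ, η, h, K` make `η(x) > 0` and `H(x) ⪯ 0` for all `x`, then
`{x : h(x) ≤ 0}` is invariant for the closed loop `ẋ = A★Z(x) + B★W(x)K(x)`. -/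
theorem data_driven_invariance
    (n m NA NB T : ℕ) (ε ω : ℝ) (hε : 0 < ε) (hω : 0 ≤ ω)
    (Z : Fin NA → MvPolynomial (Fin n) ℝ)
    (W : Fin NB → Fin m → MvPolynomial (Fin n) ℝ)
    (Astar : Matrix (Fin n) (Fin NA) ℝ) (Bstar : Matrix (Fin n) (Fin NB) ℝ)
    (xdot : Fin T → Fin n → ℝ) (z : Fin T → Fin NA → ℝ) (v : Fin T → Fin NB → ℝ)
    (hdata : ∀ j, ∃ d : Fin n → ℝ,
      xdot j = Astar.mulVec (z j) + Bstar.mulVec (v j) + d ∧ ∑ i, d i ^ 2 ≤ ω)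
    (g : Fin T → (Fin NA ⊕ Fin NB) → ℝ) (hg : ∀ j, g j = Sum.elim (z j) (v j))
    (c : Fin T → Matrix (Fin n) (Fin n) ℝ)
    (hc : ∀ j, c j = -(ω • (1 : Matrix (Fin n) (Fin n) ℝ)) + vecMulVec (xdot j) (xdot j))
    (b : Fin T → Matrix (Fin NA ⊕ Fin NB) (Fin n) ℝ)
    (hb : ∀ j, b j = -vecMulVec (g j) (xdot j))
    (a : Fin T → Matrix (Fin NA ⊕ Fin NB) (Fin NA ⊕ Fin NB) ℝ)
    (ha : ∀ j, a j = vecMulVec (g j) (g j))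
    (τ : Fin T → ℝ) (hτ : ∀ j, 0 ≤ τ j)
    (Ai : Matrix (Fin NA ⊕ Fin NB) (Fin NA ⊕ Fin NB) ℝ) (hAi : Ai.PosDef)
    (Bi : Matrix (Fin NA ⊕ Fin NB) (Fin n) ℝ)
    (hLMI : (-(Matrix.fromBlocks
        (-(1 : Matrix (Fin n) (Fin n) ℝ) - ∑ j, τ j • c j)
        (Matrix.fromCols (Biᵀ - ∑ j, τ j • (b j)ᵀ) Biᵀ)
        (Matrix.fromRows (Bi - ∑ j, τ j • b j) Bi)
        (Matrix.fromBlocks (Ai - ∑ j, τ j • a j) 0 0 (-Ai)))).PosSemidef)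
    (ζbar : Matrix (Fin NA ⊕ Fin NB) (Fin n) ℝ) (hζbar : ζbar = -(Ai⁻¹ * Bi))
    (Pbar : Matrix (Fin NA ⊕ Fin NB) (Fin NA ⊕ Fin NB) ℝ)
    (hPbar : Pbar.PosDef) (hPbarsq : Pbar * Pbar = Ai⁻¹)
    (ℓ η h : MvPolynomial (Fin n) ℝ) (K : Fin m → MvPolynomial (Fin n) ℝ)
    (w : (Fin n → ℝ) → (Fin NA ⊕ Fin NB) → ℝ)
    (hw : ∀ x : Fin n → ℝ, w x = Sum.elim (fun i => eval x (Z i))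
      (fun i => ∑ k, eval x (W i k) * eval x (K k)))
    (H : (Fin n → ℝ) →
      Matrix (Fin 1 ⊕ ((Fin NA ⊕ Fin NB) ⊕ Fin n)) (Fin 1 ⊕ ((Fin NA ⊕ Fin NB) ⊕ Fin n)) ℝ)
    (hH : ∀ x : Fin n → ℝ, H x = Matrix.fromBlocks
      (Matrix.of fun (_ _ : Fin 1) =>
        eval x ℓ * eval x h + ε + gradPoly h x ⬝ᵥ ζbarᵀ.mulVec (w x))
      (Matrix.fromCols (Matrix.of fun (_ : Fin 1) j => eval x η * Pbar.mulVec (w x) j)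
        (Matrix.of fun (_ : Fin 1) j => gradPoly h x j))
      (Matrix.fromRows (Matrix.of fun i (_ : Fin 1) => eval x η * Pbar.mulVec (w x) i)
        (Matrix.of fun i (_ : Fin 1) => gradPoly h x i))
      (Matrix.fromBlocks
        ((-(2 * eval x η)) • (1 : Matrix (Fin NA ⊕ Fin NB) (Fin NA ⊕ Fin NB) ℝ)) 0
        0 ((-(2 * eval x η)) • (1 : Matrix (Fin n) (Fin n) ℝ))))
    (hfeas : ∀ x : Fin n → ℝ, 0 < eval x η ∧ (-(H x)).PosSemidef)
    (T' : ℝ≥0∞) (hT' : 0 < T') (xc : ℝ → (Fin n → ℝ))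
    (hxc : ∀ t ∈ {s : ℝ | 0 ≤ s ∧ ENNReal.ofReal s < T'},
      HasDerivWithinAt xc
        (Astar.mulVec (fun i => eval (xc t) (Z i)) +
          Bstar.mulVec (fun i => ∑ k, eval (xc t) (W i k) * eval (xc t) (K k)))
        {s : ℝ | 0 ≤ s ∧ ENNReal.ofReal s < T'} t)
    (hx0 : eval (xc 0) h ≤ 0) :
    ∀ t ∈ {s : ℝ | 0 ≤ s ∧ ENNReal.ofReal s < T'}, eval (xc t) h ≤ 0 := by
  set ζ : Matrix (Fin NA ⊕ Fin NB) (Fin n) ℝ := Matrix.fromRows Astarᵀ Bstarᵀ with hζ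
  have hζmul : ∀ (p : Fin NA → ℝ) (q : Fin NB → ℝ),
      ζᵀ *ᵥ Sum.elim p q = Astar *ᵥ p + Bstar *ᵥ q := fun p q => by
    simp [hζ, transpose_fromRows]
  have hcons : ∀ j, ∑ i, (xdot j - ζᵀ *ᵥ g j) i ^ 2 ≤ ω := fun j => by
    obtain ⟨d, hd, hdω⟩ := hdata j
    rwa [hg, hζmul, hd, add_sub_cancel_left]
  simp only [hc, hb, ha] at hLMI
  refine nonpos_of_deriv_neg_of_eq_zero (fun t ht => hasDerivWithinAt_eval_comp h (hxc t ht))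
    (fun t _ hzero => ?_) hx0
  obtain ⟨hη, hHx⟩ := hfeas (xc t)
  rw [hH] at hHx
  have hcert := add_dotProduct_nonpos_of_certificate hAi hPbar hPbarsq hη _ _ _
    (ellipsoid_bound_of_lmi ζ xdot g hcons τ hτ hAi Bi hLMI (gradPoly h (xc t))) hHx
  have hflow : ((ζ + Ai⁻¹ * Bi) *ᵥ gradPoly h (xc t)) ⬝ᵥ w (xc t) =
      gradPoly h (xc t) ⬝ᵥ ζᵀ *ᵥ w (xc t) - gradPoly h (xc t) ⬝ᵥ ζbarᵀ *ᵥ w (xc t) := by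
    rw [← dotProduct_sub, ← sub_mulVec, ← transpose_sub, hζbar, sub_neg_eq_add, mulVec_transpose,
      dotProduct_comm, dotProduct_mulVec, dotProduct_comm]
  rw [hflow, hzero] at hcert
  rw [← hζmul, ← hw]
  linarith
end

section
/- Let n, N, T ∈ ℕ, ω ≥ 0, and let data ẋʲ ∈ ℝⁿ, gʲ ∈ ℝᴺ (j = 0,…,T−1) be given. Define cⱼ := −ωI + ẋʲ(ẋʲ)ᵀ, bⱼ := −gʲ(ẋʲ)ᵀ, aⱼ := gʲ(gʲ)ᵀ. Suppose there exist τ₀,…,τ_{T−1} ≥ 0, a symmetric positive definite A_i ∈ ℝᴺˣᴺ, and B_i ∈ ℝᴺˣⁿ such that [[−I − Σⱼ τⱼcⱼ, B_iᵀ − Σⱼ τⱼbⱼᵀ, B_iᵀ], [B_i − Σⱼ τⱼbⱼ, A_i − Σⱼ τⱼaⱼ, 0], [B_i, 0, −A_i]] ⪯ 0. Then for every ζ ∈ ℝᴺˣⁿ such that cⱼ + ζᵀbⱼ + bⱼᵀζ + ζᵀaⱼζ ⪯ 0 for all j = 0,…,T−1, it holds that (ζ + A_i⁻¹B_i)ᵀA_i(ζ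 + A_i⁻¹B_i) ⪯ I. -/
open Matrix

/-- The quadratic form of a `3 × 3` block matrix with vanishing `(2, 3)` and `(3, 2)` blocks, evaluated
at the block column `[1; Z; W]`. -/
lemma fromRows_transpose_mul_fromBlocks_mul_fromRows {m n R : Type*} [Fintype m] [Fintype n]
    [DecidableEq n] [CommRing R] (P : Matrix n n R) (Q B : Matrix m n R) (Q' B' : Matrix n m R)
    (S D : Matrix m m R) (Z W : Matrix m n R) :
    (fromRows (1 : Matrix n n R) (fromRows Z W))ᵀ * fromBlocks P (fromCols Q' B') (fromRows Q B)
        (fromBlocks S 0 0 D) * fromRows (1 : Matrix n n R) (fromRows Z W) =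
      P + Zᵀ * Q + Q' * Z + Zᵀ * S * Z + Wᵀ * B + B' * W + Wᵀ * D * W := by
  have hadd (X₁ X₂ Y₁ Y₂ : Matrix m n R) :
      fromRows X₁ X₂ + fromRows Y₁ Y₂ = fromRows (X₁ + Y₁) (X₂ + Y₂) := by
    ext (i | i) j <;> rfl
  simp only [transpose_fromRows, Matrix.mul_assoc, fromBlocks_mul_fromRows, fromCols_mul_fromRows,
    transpose_one, Matrix.one_mul, Matrix.mul_one, Matrix.zero_mul, Matrix.mul_add, add_zero,
    zero_add, hadd]
  abel

/-- If `(τ, A_i, B_i)` with `τ ≥ 0`, `A_i ≻ 0` satisfy the LMI, then any `ζ` consistent with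
every data point (i.e. `cⱼ + ζᵀbⱼ + bⱼᵀζ + ζᵀaⱼζ ⪯ 0` for all `j`) satisfies
`(ζ + A_i⁻¹B_i)ᵀ A_i (ζ + A_i⁻¹B_i) ⪯ I`. -/
theorem consistency_set_in_ellipsoid (n N T : ℕ) (ω : ℝ) (hω : 0 ≤ ω)
    (xdot : Fin T → Fin n → ℝ) (g : Fin T → Fin N → ℝ)
    (c : Fin T → Matrix (Fin n) (Fin n) ℝ)
    (hc : ∀ j, c j = -(ω • (1 : Matrix (Fin n) (Fin n) ℝ)) + vecMulVec (xdot j) (xdot j))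
    (b : Fin T → Matrix (Fin N) (Fin n) ℝ)
    (hb : ∀ j, b j = -vecMulVec (g j) (xdot j))
    (a : Fin T → Matrix (Fin N) (Fin N) ℝ)
    (ha : ∀ j, a j = vecMulVec (g j) (g j))
    (τ : Fin T → ℝ) (hτ : ∀ j, 0 ≤ τ j)
    (Ai : Matrix (Fin N) (Fin N) ℝ) (hAi : Ai.PosDef)
    (Bi : Matrix (Fin N) (Fin n) ℝ)
    (hLMI : (-(Matrix.fromBlocks
        (-(1 : Matrix (Fin n) (Fin n) ℝ) - ∑ j, τ j • c j)
        (Matrix.fromCols (Biᵀ - ∑ j, τ j • (b j)ᵀ) Biᵀ)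
        (Matrix.fromRows (Bi - ∑ j, τ j • b j) Bi)
        (Matrix.fromBlocks (Ai - ∑ j, τ j • a j) 0 0 (-Ai)))).PosSemidef) :
    ∀ ζ : Matrix (Fin N) (Fin n) ℝ,
      (∀ j, (-(c j + ζᵀ * b j + (b j)ᵀ * ζ + ζᵀ * a j * ζ)).PosSemidef) →
      ((1 : Matrix (Fin n) (Fin n) ℝ) -
        (ζ + Ai⁻¹ * Bi)ᵀ * Ai * (ζ + Ai⁻¹ * Bi)).PosSemidef := by
  intro ζ hζ
  have hdet : IsUnit Ai.det := hAi.det_pos.ne'.isUnit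
  have hAt : Aiᵀ = Ai := by simpa using hAi.isHermitian.eq
  obtain ⟨W, hW⟩ : ∃ W, W = Ai⁻¹ * Bi := ⟨_, rfl⟩
  have hB : Bi = Ai * W := by rw [hW, mul_nonsing_inv_cancel_left _ _ hdet]
  have hBt : Biᵀ = Wᵀ * Ai := by rw [hB, transpose_mul, hAt]
  have hcongr := hLMI.conjTranspose_mul_mul_same (fromRows 1 (fromRows ζ W))
  rw [conjTranspose_eq_transpose_of_trivial, Matrix.mul_neg, Matrix.neg_mul,
    fromRows_transpose_mul_fromBlocks_mul_fromRows] at hcongr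
  have hsum : (∑ j, τ j • -(c j + ζᵀ * b j + (b j)ᵀ * ζ + ζᵀ * a j * ζ)).PosSemidef :=
    posSemidef_sum _ fun j _ => (hζ j).smul (hτ j)
  rw [← hW]
  convert hcongr.add hsum using 1
  have hexpand : ∑ j, τ j • -(c j + ζᵀ * b j + (b j)ᵀ * ζ + ζᵀ * a j * ζ) =
      -(∑ j, τ j • c j + ζᵀ * ∑ j, τ j • b j + (∑ j, τ j • (b j)ᵀ) * ζ
        + ζᵀ * (∑ j, τ j • a j) * ζ) := by
    simp only [Matrix.mul_sum, Matrix.sum_mul, Matrix.mul_smul, Matrix.smul_mul, smul_neg,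
      smul_add, Finset.sum_neg_distrib, Finset.sum_add_distrib]
  rw [hexpand, hBt, hB]
  simp only [transpose_add, Matrix.add_mul, Matrix.mul_add, Matrix.sub_mul, Matrix.mul_sub,
    Matrix.mul_neg, Matrix.neg_mul, Matrix.mul_assoc]
  abel
end
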